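/- arXiv:2504.11387 — 3 statements merged into one kernel-verified Lean document; each statement's English description precedes it below -/
import Mathlib

section
/- Let λ, c > 0. On the open region {(x,t) : t > 0, 0 < x < ct}, the function q_{λ,c}(x,t) is smooth and satisfies the hyperbolic partial differential equation ∂²q/∂t² − c² ∂²q/∂x² + 2λ ∂q/∂t − (2a(t)/t) ∂q/∂t = ( λ/t − 2a(t)/t² ) q, where a(t) = I₁(λt)/(I₀(λt)+I₁(λt)). -/
open Real

/-- Modified Bessel function of the first kind,
`I_ν(x) = ∑_{k≥0} (x/2)^{2k+ν} / (k! Γ(ν+k+1))`. -/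
noncomputable def besselI (ν x : ℝ) : ℝ :=
  ∑' k : ℕ, (x / 2) ^ (2 * (k : ℝ) + ν) / ((k.factorial : ℝ) * Real.Gamma (ν + k + 1))

/-- Absolutely continuous component of the law of the telegraph meander at its end time. -/
noncomputable def qdens (lam c x t : ℝ) : ℝ :=
  (1 / (besselI 0 (lam * t) + besselI 1 (lam * t))) *
    (lam * x * besselI 0 (lam / c * Real.sqrt (c ^ 2 * t ^ 2 - x ^ 2)) / (c * (c * t + x))
      + besselI 1 (lam / c * Real.sqrt (c ^ 2 * t ^ 2 - x ^ 2))
          / Real.sqrt (c ^ 2 * t ^ 2 - x ^ 2)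
          * (lam * x / c + (c * t - x) / (c * t + x)))

/-- The coefficient `a(t) = I₁(λt)/(I₀(λt)+I₁(λt))`. -/
noncomputable def acoef (lam t : ℝ) : ℝ :=
  besselI 1 (lam * t) / (besselI 0 (lam * t) + besselI 1 (lam * t))

/-- Entire function `∑ w^k / (k! (k+n)!)`, so that `I_n(x) = (x/2)^n besselEntire n (x²/4)`. -/
noncomputable def besselEntire (n : ℕ) (w : ℝ) : ℝ :=
  ∑' k : ℕ, w ^ k / ((k.factorial : ℝ) * ((k + n).factorial : ℝ))

lemma summable_besselEntire (n : ℕ) (w : ℝ) :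
    Summable fun k : ℕ => w ^ k / ((k.factorial : ℝ) * ((k + n).factorial : ℝ)) := by
  refine Summable.of_norm_bounded (Real.summable_pow_div_factorial |w|) fun k => ?_
  rw [norm_div, norm_pow, Real.norm_eq_abs, norm_mul, Real.norm_natCast, Real.norm_natCast]
  have h1 : (0 : ℝ) < k.factorial := by positivity
  have h2 : (1 : ℝ) ≤ (k + n).factorial := by exact_mod_cast Nat.factorial_pos (k + n)
  gcongr
  nlinarith

lemma besselEntire_pos (n : ℕ) {w : ℝ} (hw : 0 ≤ w) : 0 < besselEntire n w := by
  refine (summable_besselEntire n w).tsum_pos (fun k => by positivity) 0 ?_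
  simp only [pow_zero]
  positivity

lemma hasDerivAt_besselEntire (n : ℕ) (w : ℝ) :
    HasDerivAt (besselEntire n) (besselEntire (n + 1) w) w := by
  have hshift : ∀ (y : ℝ) (k : ℕ),
      ((k + 1 : ℕ) : ℝ) * y ^ (k + 1 - 1) / (((k + 1).factorial : ℝ) * ((k + 1 + n).factorial : ℝ))
        = y ^ k / ((k.factorial : ℝ) * ((k + (n + 1)).factorial : ℝ)) := by
    intro y k
    rw [Nat.factorial_succ k, Nat.add_sub_cancel, show k + 1 + n = k + (n + 1) by ring]
    push_cast
    have : (k.factorial : ℝ) ≠ 0 := by positivity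
    have : ((k + (n + 1)).factorial : ℝ) ≠ 0 := by positivity
    field_simp
  have hsum : ∀ y : ℝ, Summable fun k : ℕ =>
      (k : ℝ) * y ^ (k - 1) / ((k.factorial : ℝ) * ((k + n).factorial : ℝ)) := by
    intro y
    rw [← summable_nat_add_iff 1]
    simp only [hshift]
    exact summable_besselEntire (n + 1) y
  have key := hasDerivAt_tsum_of_isPreconnected (𝕜 := ℝ) (F := ℝ) (t := Metric.ball 0 (|w| + 1))
    (g := fun (k : ℕ) y => y ^ k / ((k.factorial : ℝ) * ((k + n).factorial : ℝ)))
    (g' := fun (k : ℕ) y =>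
      (k : ℝ) * y ^ (k - 1) / ((k.factorial : ℝ) * ((k + n).factorial : ℝ)))
    (y₀ := w) (y := w)
    (hsum (|w| + 1)) Metric.isOpen_ball (convex_ball _ _).isPreconnected
    (fun k y _ => (hasDerivAt_pow k y).div_const _)
    (fun k y hy => by
      rw [mem_ball_zero_iff, Real.norm_eq_abs] at hy
      rw [norm_div, norm_mul, norm_pow, Real.norm_eq_abs y, norm_mul, Real.norm_natCast,
        Real.norm_natCast, Real.norm_natCast]
      gcongr)
    (by simp) (summable_besselEntire n w) (by simp)
  rw [(hsum w).tsum_eq_zero_add] at key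
  simp only [hshift] at key
  simp only [CharP.cast_eq_zero, zero_mul, zero_div, zero_add] at key
  exact key

lemma contDiff_besselEntire (n : ℕ) : ContDiff ℝ (⊤ : ℕ∞) (besselEntire n) := by
  rw [contDiff_infty]
  intro m
  induction m generalizing n with
  | zero =>
    exact contDiff_zero.2
      (continuous_iff_continuousAt.2 fun w => (hasDerivAt_besselEntire n w).continuousAt)
  | succ m ih =>
    push_cast
    rw [contDiff_succ_iff_deriv]
    refine ⟨fun w => (hasDerivAt_besselEntire n w).differentiableAt, by simp, ?_⟩
    rw [show deriv (besselEntire n) = besselEntire (n + 1) from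
      funext fun w => (hasDerivAt_besselEntire n w).deriv]
    exact ih (n + 1)

lemma besselEntire_recurrence (n : ℕ) (w : ℝ) :
    besselEntire n w = (n + 1) * besselEntire (n + 1) w + w * besselEntire (n + 2) w := by
  have h1 := summable_besselEntire (n + 1) w
  have h2 := summable_besselEntire (n + 2) w
  have h3 : (Summable fun k : ℕ =>
      (k : ℝ) * w ^ k / ((k.factorial : ℝ) * ((k + (n + 1)).factorial : ℝ))) ∧
      ∑' k : ℕ, (k : ℝ) * w ^ k / ((k.factorial : ℝ) * ((k + (n + 1)).factorial : ℝ))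
        = w * besselEntire (n + 2) w := by
    have hshift : ∀ k : ℕ, ((k + 1 : ℕ) : ℝ) * w ^ (k + 1) /
        (((k + 1).factorial : ℝ) * ((k + 1 + (n + 1)).factorial : ℝ))
        = w * (w ^ k / ((k.factorial : ℝ) * ((k + (n + 2)).factorial : ℝ))) := by
      intro k
      rw [Nat.factorial_succ k, show k + 1 + (n + 1) = k + (n + 2) by ring]
      push_cast
      have : (k.factorial : ℝ) ≠ 0 := by positivity
      have : ((k + (n + 2)).factorial : ℝ) ≠ 0 := by positivity
      field_simp
      ring
    have hs : Summable fun k : ℕ =>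
        (k : ℝ) * w ^ k / ((k.factorial : ℝ) * ((k + (n + 1)).factorial : ℝ)) := by
      rw [← summable_nat_add_iff 1]
      simp only [hshift]
      exact h2.mul_left w
    refine ⟨hs, ?_⟩
    rw [hs.tsum_eq_zero_add]
    simp only [hshift, tsum_mul_left]
    simp [besselEntire]
  rw [← h3.2]
  unfold besselEntire
  rw [← tsum_mul_left, ← (h1.mul_left _).tsum_add h3.1]
  refine tsum_congr fun k => ?_
  rw [show k + (n + 1) = (k + n) + 1 by ring, Nat.factorial_succ (k + n)]
  push_cast
  have : (k.factorial : ℝ) ≠ 0 := by positivity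
  have : ((k + n).factorial : ℝ) ≠ 0 := by positivity
  field_simp
  ring

lemma besselI_natCast (n : ℕ) (x : ℝ) :
    besselI n x = (x / 2) ^ n * besselEntire n (x ^ 2 / 4) := by
  unfold besselI besselEntire
  rw [← tsum_mul_left]
  refine tsum_congr fun k => ?_
  rw [show 2 * (k : ℝ) + n = ((2 * k + n : ℕ) : ℝ) by push_cast; ring, Real.rpow_natCast,
    show (n : ℝ) + k + 1 = ((k + n : ℕ) : ℝ) + 1 by push_cast; ring,
    Real.Gamma_nat_eq_factorial, pow_add, pow_mul, show x ^ 2 / 4 = (x / 2) ^ 2 by ring]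
  ring

lemma besselI_zero (x : ℝ) : besselI 0 x = besselEntire 0 (x ^ 2 / 4) := by
  simpa using besselI_natCast 0 x

lemma besselI_one (x : ℝ) :
    besselI 1 x = x / 2 * besselEntire 1 (x ^ 2 / 4) := by
  simpa using besselI_natCast 1 x

/-- The numerator of `qdens` (with `k = lam / c`), written as an entire function of `x` and `t`. -/
noncomputable def meanderNum (k c x t : ℝ) : ℝ :=
  k / 2 * (besselEntire 0 (k ^ 2 * (c ^ 2 * t ^ 2 - x ^ 2) / 4)
    + k * x * besselEntire 1 (k ^ 2 * (c ^ 2 * t ^ 2 - x ^ 2) / 4)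
    - k ^ 2 / 4 * (c * t - x) ^ 2 * besselEntire 2 (k ^ 2 * (c ^ 2 * t ^ 2 - x ^ 2) / 4))

/-- The normalizing factor `I₀(λt) + I₁(λt)`, written as an entire function of `t`. -/
noncomputable def meanderDen (lam t : ℝ) : ℝ :=
  besselEntire 0 (lam ^ 2 * t ^ 2 / 4) + lam * t / 2 * besselEntire 1 (lam ^ 2 * t ^ 2 / 4)

lemma meanderDen_pos {lam t : ℝ} (hlam : 0 < lam) (ht : 0 < t) : 0 < meanderDen lam t := by
  have h0 := besselEntire_pos 0 (w := lam ^ 2 * t ^ 2 / 4) (by positivity)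
  have h1 := besselEntire_pos 1 (w := lam ^ 2 * t ^ 2 / 4) (by positivity)
  unfold meanderDen
  positivity

lemma besselI_zero_add_one (lam t : ℝ) :
    besselI 0 (lam * t) + besselI 1 (lam * t) = meanderDen lam t := by
  rw [besselI_zero, besselI_one, meanderDen, mul_pow]

lemma qdens_eq {lam c x t : ℝ} (hlam : 0 < lam) (hc : 0 < c) (ht : 0 < t) (hx : 0 < x)
    (hxt : x < c * t) :
    qdens lam c x t = meanderNum (lam / c) c x t / meanderDen lam t := by
  have hpos : 0 < c ^ 2 * t ^ 2 - x ^ 2 := by nlinarith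
  have hs := Real.sqrt_pos.2 hpos
  have hk : 0 < lam / c := div_pos hlam hc
  have hD := meanderDen_pos hlam ht
  rw [qdens, besselI_zero_add_one, besselI_zero,
    besselI_one, mul_pow, Real.sq_sqrt hpos.le, meanderNum]
  obtain ⟨k, rfl⟩ : ∃ k, lam = k * c := ⟨lam / c, by field_simp⟩
  rw [mul_div_cancel_right₀ k hc.ne'] at *
  have hr := besselEntire_recurrence 0 (k ^ 2 * (c ^ 2 * t ^ 2 - x ^ 2) / 4)
  norm_num at hr
  generalize besselEntire 0 (k ^ 2 * (c ^ 2 * t ^ 2 - x ^ 2) / 4) = A at *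
  generalize besselEntire 1 (k ^ 2 * (c ^ 2 * t ^ 2 - x ^ 2) / 4) = B at *
  generalize besselEntire 2 (k ^ 2 * (c ^ 2 * t ^ 2 - x ^ 2) / 4) = C at *
  generalize √(c ^ 2 * t ^ 2 - x ^ 2) = s at *
  have hξ : c * t + x ≠ 0 := by positivity
  subst hr
  field_simp
  ring

lemma HasDerivAt.besselEntire {n : ℕ} {f : ℝ → ℝ} {f' t : ℝ} (hf : HasDerivAt f f' t) :
    HasDerivAt (fun u => besselEntire n (f u)) (besselEntire (n + 1) (f t) * f') t :=
  (hasDerivAt_besselEntire n (f t)).comp t hf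

lemma contDiff_meanderNum (k c : ℝ) :
    ContDiff ℝ (⊤ : ℕ∞) fun p : ℝ × ℝ => meanderNum k c p.1 p.2 := by
  have h : ∀ n, ContDiff ℝ (⊤ : ℕ∞) fun p : ℝ × ℝ =>
      besselEntire n (k ^ 2 * (c ^ 2 * p.2 ^ 2 - p.1 ^ 2) / 4) := fun n =>
    (contDiff_besselEntire n).comp (by fun_prop)
  have h0 := h 0
  have h1 := h 1
  have h2 := h 2
  unfold meanderNum
  fun_prop

lemma contDiff_meanderDen (lam : ℝ) : ContDiff ℝ (⊤ : ℕ∞) (meanderDen lam) := by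
  have h : ∀ n, ContDiff ℝ (⊤ : ℕ∞) fun t : ℝ => besselEntire n (lam ^ 2 * t ^ 2 / 4) :=
    fun n => (contDiff_besselEntire n).comp (by fun_prop)
  have h0 := h 0
  have h1 := h 1
  unfold meanderDen
  fun_prop

/-- First and second derivatives of `x ↦ meanderNum k c x t` and `t ↦ meanderNum k c x t`,
tied together by the Klein–Gordon equation. -/
lemma meanderNum_kleinGordon (k c : ℝ) :
    ∃ Nt Ntt Nx Nxx : ℝ → ℝ → ℝ,
      (∀ x t, HasDerivAt (fun u => meanderNum k c x u) (Nt x t) t) ∧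
      (∀ x t, HasDerivAt (fun u => Nt x u) (Ntt x t) t) ∧
      (∀ x t, HasDerivAt (fun y => meanderNum k c y t) (Nx x t) x) ∧
      (∀ x t, HasDerivAt (fun y => Nx y t) (Nxx x t) x) ∧
      ∀ x t, Ntt x t - c ^ 2 * Nxx x t = (k * c) ^ 2 * meanderNum k c x t := by
  let w : ℝ → ℝ → ℝ := fun x t => k ^ 2 * (c ^ 2 * t ^ 2 - x ^ 2) / 4
  have hwt : ∀ x t, HasDerivAt (fun u => w x u) (k ^ 2 * c ^ 2 * t / 2) t := fun x t =>
    (((((hasDerivAt_id t).pow 2).const_mul (c ^ 2)).sub_const (x ^ 2)).const_mul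
      (k ^ 2) |>.div_const 4).congr_deriv (by simp; ring)
  have hwx : ∀ x t, HasDerivAt (fun y => w y t) (-(k ^ 2 * x / 2)) x := fun x t =>
    ((((hasDerivAt_id x).pow 2).const_sub (c ^ 2 * t ^ 2)).const_mul
      (k ^ 2) |>.div_const 4).congr_deriv (by simp; ring)
  have hFt : ∀ n x t, HasDerivAt (fun u => besselEntire n (w x u))
      (besselEntire (n + 1) (w x t) * (k ^ 2 * c ^ 2 * t / 2)) t := fun n x t =>
    (hwt x t).besselEntire
  have hFx : ∀ n x t, HasDerivAt (fun y => besselEntire n (w y t))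
      (besselEntire (n + 1) (w x t) * (-(k ^ 2 * x / 2))) x := fun n x t =>
    (hwx x t).besselEntire
  have het : ∀ x t, HasDerivAt (fun u => c * u - x) c t := fun x t =>
    (((hasDerivAt_id t).const_mul c).sub_const x).congr_deriv (by simp)
  have hex : ∀ x t, HasDerivAt (fun y => c * t - y) (-1) x := fun x t =>
    (hasDerivAt_id x).const_sub (c * t)
  have hkt : ∀ t, HasDerivAt (fun u : ℝ => k ^ 2 * c ^ 2 * u / 2) (k ^ 2 * c ^ 2 / 2) t := fun t =>
    (((hasDerivAt_id t).const_mul (k ^ 2 * c ^ 2)).div_const 2).congr_deriv (by simp)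
  have hkx : ∀ x, HasDerivAt (fun y : ℝ => -(k ^ 2 * y / 2)) (-(k ^ 2 / 2)) x := fun x =>
    (((hasDerivAt_id x).const_mul (k ^ 2)).div_const 2).neg.congr_deriv (by simp)
  have hkid : ∀ x, HasDerivAt (fun y : ℝ => k * y) k x := fun x =>
    ((hasDerivAt_id x).const_mul k).congr_deriv (by simp)
  let F : ℕ → ℝ → ℝ → ℝ := fun n x t => besselEntire n (w x t)
  refine ⟨fun x t => k / 2 * (F 1 x t * (k ^ 2 * c ^ 2 * t / 2)
      + k * x * (F 2 x t * (k ^ 2 * c ^ 2 * t / 2))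
      - (k ^ 2 / 4 * (2 * c) * ((c * t - x) * F 2 x t)
        + k ^ 2 / 4 * ((c * t - x) ^ 2 * (F 3 x t * (k ^ 2 * c ^ 2 * t / 2))))),
    fun x t => k / 2 * ((F 2 x t * (k ^ 2 * c ^ 2 * t / 2) * (k ^ 2 * c ^ 2 * t / 2)
        + F 1 x t * (k ^ 2 * c ^ 2 / 2))
      + k * x * (F 3 x t * (k ^ 2 * c ^ 2 * t / 2) * (k ^ 2 * c ^ 2 * t / 2)
        + F 2 x t * (k ^ 2 * c ^ 2 / 2))
      - (k ^ 2 / 4 * (2 * c) * (c * F 2 x t + (c * t - x) * (F 3 x t * (k ^ 2 * c ^ 2 * t / 2)))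
        + k ^ 2 / 4 * (2 * c * (c * t - x) * (F 3 x t * (k ^ 2 * c ^ 2 * t / 2))
          + (c * t - x) ^ 2 * (F 4 x t * (k ^ 2 * c ^ 2 * t / 2) * (k ^ 2 * c ^ 2 * t / 2)
            + F 3 x t * (k ^ 2 * c ^ 2 / 2))))),
    fun x t => k / 2 * (F 1 x t * (-(k ^ 2 * x / 2))
      + (k * F 1 x t + k * x * (F 2 x t * (-(k ^ 2 * x / 2))))
      - (k ^ 2 / 4 * (-2) * ((c * t - x) * F 2 x t)
        + k ^ 2 / 4 * ((c * t - x) ^ 2 * (F 3 x t * (-(k ^ 2 * x / 2)))))),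
    fun x t => k / 2 * ((F 2 x t * (-(k ^ 2 * x / 2)) * (-(k ^ 2 * x / 2))
        + F 1 x t * (-(k ^ 2 / 2)))
      + (k * (F 2 x t * (-(k ^ 2 * x / 2))) + (k * (F 2 x t * (-(k ^ 2 * x / 2)))
        + k * x * (F 3 x t * (-(k ^ 2 * x / 2)) * (-(k ^ 2 * x / 2)) + F 2 x t * (-(k ^ 2 / 2)))))
      - (k ^ 2 / 4 * (-2) * (-F 2 x t + (c * t - x) * (F 3 x t * (-(k ^ 2 * x / 2))))
        + k ^ 2 / 4 * (-2 * (c * t - x) * (F 3 x t * (-(k ^ 2 * x / 2)))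
          + (c * t - x) ^ 2 * (F 4 x t * (-(k ^ 2 * x / 2)) * (-(k ^ 2 * x / 2))
            + F 3 x t * (-(k ^ 2 / 2)))))),
    fun x t => ?_, fun x t => ?_, fun x t => ?_, fun x t => ?_, fun x t => ?_⟩
  · exact ((((hFt 0 x t).add ((hFt 1 x t).const_mul (k * x))).sub
      ((((het x t).pow 2).const_mul (k ^ 2 / 4)).mul (hFt 2 x t))).const_mul (k / 2)).congr_deriv
      (by simp only [F, Nat.cast_ofNat, Pi.pow_apply]; ring)
  · exact (((((hFt 1 x t).mul (hkt t)).add (((hFt 2 x t).mul (hkt t)).const_mul (k * x))).sub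
      ((((het x t).mul (hFt 2 x t)).const_mul (k ^ 2 / 4 * (2 * c))).add
        ((((het x t).pow 2).mul ((hFt 3 x t).mul (hkt t))).const_mul (k ^ 2 / 4)))).const_mul
          (k / 2)).congr_deriv (by
            simp only [F, Nat.cast_ofNat, Pi.pow_apply, Pi.mul_apply]; ring)
  · exact ((((hFx 0 x t).add ((hkid x).mul (hFx 1 x t))).sub
      ((((hex x t).pow 2).const_mul (k ^ 2 / 4)).mul (hFx 2 x t))).const_mul (k / 2)).congr_deriv
      (by simp only [F, Nat.cast_ofNat, Pi.pow_apply]; ring)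
  · exact (((((hFx 1 x t).mul (hkx x)).add (((hFx 1 x t).const_mul k).add
      ((hkid x).mul ((hFx 2 x t).mul (hkx x))))).sub
      ((((hex x t).mul (hFx 2 x t)).const_mul (k ^ 2 / 4 * (-2))).add
        ((((hex x t).pow 2).mul ((hFx 3 x t).mul (hkx x))).const_mul (k ^ 2 / 4)))).const_mul
          (k / 2)).congr_deriv (by
            simp only [F, Nat.cast_ofNat, Pi.pow_apply, Pi.mul_apply]; ring)
  · have h0 := besselEntire_recurrence 0 (w x t)
    have h1 := besselEntire_recurrence 1 (w x t)
    have h2 := besselEntire_recurrence 2 (w x t)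
    norm_num at h0 h1 h2
    have hN : meanderNum k c x t = k / 2 * (F 0 x t + k * x * F 1 x t
      - k ^ 2 / 4 * (c * t - x) ^ 2 * F 2 x t) := rfl
    rw [hN]
    simp only [F]
    rw [h0, h1, h2]
    generalize besselEntire 3 (w x t) = C
    generalize besselEntire 4 (w x t) = E
    simp only [w]
    ring

/-- First and second derivatives of the normalizing factor, expressed through the factor itself
and `I₁(λt) = (λt/2) besselEntire 1 (λ²t²/4)`. -/
lemma meanderDen_deriv (lam : ℝ) :
    ∃ D' D'' : ℝ → ℝ,
      (∀ t, HasDerivAt (meanderDen lam) (D' t) t) ∧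
      (∀ t, HasDerivAt D' (D'' t) t) ∧
      (∀ t, t * D' t = lam * t * meanderDen lam t
        - lam * t / 2 * besselEntire 1 (lam ^ 2 * t ^ 2 / 4)) ∧
      ∀ t, t ^ 2 * D'' t = (lam ^ 2 * t ^ 2 - lam * t) * meanderDen lam t
        + 2 * (lam * t / 2 * besselEntire 1 (lam ^ 2 * t ^ 2 / 4)) := by
  have hv : ∀ t, HasDerivAt (fun u => lam ^ 2 * u ^ 2 / 4) (lam ^ 2 * t / 2) t := fun t =>
    ((((hasDerivAt_id t).pow 2).const_mul (lam ^ 2)).div_const 4).congr_deriv (by simp; ring)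
  let F : ℕ → ℝ → ℝ := fun n t => besselEntire n (lam ^ 2 * t ^ 2 / 4)
  have hF : ∀ n t, HasDerivAt (F n) (F (n + 1) t * (lam ^ 2 * t / 2)) t := fun n t =>
    (hv t).besselEntire
  have hl : ∀ t, HasDerivAt (fun u => lam * u / 2) (lam / 2) t := fun t =>
    (((hasDerivAt_id t).const_mul lam).div_const 2).congr_deriv (by simp)
  have hl2 : ∀ t, HasDerivAt (fun u => lam ^ 2 * u / 2) (lam ^ 2 / 2) t := fun t =>
    (((hasDerivAt_id t).const_mul (lam ^ 2)).div_const 2).congr_deriv (by simp)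
  have hr : ∀ t, F 0 t = F 1 t + lam ^ 2 * t ^ 2 / 4 * F 2 t ∧
      F 1 t = 2 * F 2 t + lam ^ 2 * t ^ 2 / 4 * F 3 t := fun t => by
    have h0 := besselEntire_recurrence 0 (lam ^ 2 * t ^ 2 / 4)
    have h1 := besselEntire_recurrence 1 (lam ^ 2 * t ^ 2 / 4)
    norm_num at h0 h1
    exact ⟨h0, h1⟩
  have hD : ∀ t, meanderDen lam t = F 0 t + lam * t / 2 * F 1 t := fun t => rfl
  refine ⟨fun t => F 1 t * (lam ^ 2 * t / 2) + (lam / 2 * F 1 t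
      + lam * t / 2 * (F 2 t * (lam ^ 2 * t / 2))),
    fun t => (F 2 t * (lam ^ 2 * t / 2) * (lam ^ 2 * t / 2) + F 1 t * (lam ^ 2 / 2))
      + (lam / 2 * (F 2 t * (lam ^ 2 * t / 2)) + (lam / 2 * (F 2 t * (lam ^ 2 * t / 2))
      + lam * t / 2 * (F 3 t * (lam ^ 2 * t / 2) * (lam ^ 2 * t / 2) + F 2 t * (lam ^ 2 / 2)))),
    fun t => ?_, fun t => ?_, fun t => ?_, fun t => ?_⟩
  · exact (hF 0 t).add ((hl t).mul (hF 1 t))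
  · exact ((hF 1 t).mul (hl2 t)).add (((hF 1 t).const_mul (lam / 2)).add
      ((hl t).mul ((hF 2 t).mul (hl2 t))))
  · obtain ⟨h0, h1⟩ := hr t
    change _ = _ - lam * t / 2 * F 1 t
    rw [hD, h0]
    ring
  · obtain ⟨h0, h1⟩ := hr t
    change _ = _ + 2 * (lam * t / 2 * F 1 t)
    rw [hD]
    linear_combination (lam * t - lam ^ 2 * t ^ 2) * h0 - lam ^ 3 * t ^ 3 / 2 * h1

theorem stmt_3 (lam c : ℝ) (hlam : 0 < lam) (hc : 0 < c) :
    ContDiffOn ℝ (⊤ : ℕ∞) (fun p : ℝ × ℝ => qdens lam c p.1 p.2)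
      {p : ℝ × ℝ | 0 < p.2 ∧ 0 < p.1 ∧ p.1 < c * p.2} ∧
    ∀ x t : ℝ, 0 < t → 0 < x → x < c * t →
      deriv (fun s => deriv (fun u => qdens lam c x u) s) t
          - c ^ 2 * deriv (fun y => deriv (fun z => qdens lam c z t) y) x
          + 2 * lam * deriv (fun u => qdens lam c x u) t
          - (2 * acoef lam t / t) * deriv (fun u => qdens lam c x u) t
        = (lam / t - 2 * acoef lam t / t ^ 2) * qdens lam c x t := by
  refine ⟨?_, fun x t ht hx hxt => ?_⟩
  · refine ContDiffOn.congr (f := fun p : ℝ × ℝ =>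
      meanderNum (lam / c) c p.1 p.2 / meanderDen lam p.2) ?_
      fun p hp => qdens_eq hlam hc hp.1 hp.2.1 hp.2.2
    exact (contDiff_meanderNum _ _).contDiffOn.div
      ((contDiff_meanderDen lam).comp contDiff_snd).contDiffOn
      fun p hp => (meanderDen_pos hlam hp.1).ne'
  obtain ⟨Nt, Ntt, Nx, Nxx, hNt, hNtt, hNx, hNxx, hKG⟩ := meanderNum_kleinGordon (lam / c) c
  obtain ⟨D', D'', hD, hD', hDe, hDe'⟩ := meanderDen_deriv lam
  have hDpos : ∀ s, 0 < s → meanderDen lam s ≠ 0 := fun s hs => (meanderDen_pos hlam hs).ne'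
  have hopen_t : IsOpen {s : ℝ | 0 < s ∧ x < c * s} :=
    (isOpen_lt continuous_const continuous_id).inter
      (isOpen_lt continuous_const (continuous_const.mul continuous_id))
  have hopen_x : IsOpen {y : ℝ | 0 < y ∧ y < c * t} :=
    (isOpen_lt continuous_const continuous_id).inter
      (isOpen_lt continuous_id continuous_const)
  have hqt : ∀ s, 0 < s ∧ x < c * s → HasDerivAt (fun u => qdens lam c x u)
      ((Nt x s * meanderDen lam s - meanderNum (lam / c) c x s * D' s) /
        meanderDen lam s ^ 2) s := fun s hs =>
    ((hNt x s).div (hD s) (hDpos s hs.1)).congr_of_eventuallyEq <| by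
      filter_upwards [hopen_t.mem_nhds hs] with u hu
      exact qdens_eq hlam hc hu.1 hx hu.2
  have hqx : ∀ y, 0 < y ∧ y < c * t → HasDerivAt (fun z => qdens lam c z t)
      (Nx y t / meanderDen lam t) y := fun y hy =>
    ((hNx y t).div_const _).congr_of_eventuallyEq <| by
      filter_upwards [hopen_x.mem_nhds hy] with u hu
      exact qdens_eq hlam hc ht hu.1 hu.2
  have hqtt : deriv (fun s => deriv (fun u => qdens lam c x u) s) t = _ :=
    HasDerivAt.deriv <|
      ((((hNtt x t).mul (hD t)).sub ((hNt x t).mul (hD' t))).div ((hD t).pow 2)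
        (pow_ne_zero 2 (hDpos t ht))).congr_of_eventuallyEq <| by
      filter_upwards [hopen_t.mem_nhds ⟨ht, hxt⟩] with s hs
      exact (hqt s hs).deriv
  have hqxx : deriv (fun y => deriv (fun z => qdens lam c z t) y) x
      = Nxx x t / meanderDen lam t :=
    HasDerivAt.deriv <| ((hNxx x t).div_const _).congr_of_eventuallyEq <| by
      filter_upwards [hopen_x.mem_nhds ⟨hx, hxt⟩] with y hy
      exact (hqx y hy).deriv
  have hKG' := hKG x t
  rw [div_mul_cancel₀ lam hc.ne'] at hKG'
  rw [hqtt, hqxx, (hqt t ⟨ht, hxt⟩).deriv, qdens_eq hlam hc ht hx hxt, acoef,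
    besselI_zero_add_one, besselI_one, mul_pow]
  have hD1 : D' t = (lam * t * meanderDen lam t
      - lam * t / 2 * besselEntire 1 (lam ^ 2 * t ^ 2 / 4)) / t := by
    rw [← hDe t, mul_div_cancel_left₀ _ ht.ne']
  have hD2 : D'' t = ((lam ^ 2 * t ^ 2 - lam * t) * meanderDen lam t
      + 2 * (lam * t / 2 * besselEntire 1 (lam ^ 2 * t ^ 2 / 4))) / t ^ 2 := by
    rw [← hDe' t, mul_div_cancel_left₀ _ (pow_ne_zero 2 ht.ne')]
  have hN2 : Ntt x t = c ^ 2 * Nxx x t + lam ^ 2 * meanderNum (lam / c) c x t := by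
    linear_combination hKG'
  have hDne := hDpos t ht
  have htne := ht.ne'
  simp only [Pi.mul_apply, Pi.sub_apply, Pi.pow_apply, hD1, hD2, hN2]
  field_simp
  ring
end

section
/- Let λ, c > 0, t > 0 and p > 0. Then the p-th moment of the telegraph meander at time t, namely (ct)^p/(I₀(λt)+I₁(λt)) + ∫₀^{ct} x^p q_{λ,c}(x,t) dx, equals (2c²t/λ)^{p/2} [ Γ(p/2+1)(I_{p/2}(λt)+I_{p/2−1}(λt)) − (p/2)Γ((p+1)/2)√(2/(λt)) I_{(p−1)/2}(λt) ] / (I₀(λt)+I₁(λt)). -/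
open Real intervalIntegral

lemma summable_mul_pow_of_abs_le_inv_factorial {b : ℕ → ℝ}
    (hb : ∀ k, |b k| ≤ 1 / (k.factorial : ℝ)) (y : ℝ) : Summable fun k => b k * y ^ k := by
  refine Summable.of_norm_bounded (Real.summable_pow_div_factorial |y|) fun k => ?_
  rw [norm_mul, norm_pow, Real.norm_eq_abs, Real.norm_eq_abs, div_eq_inv_mul, ← one_div]
  exact mul_le_mul_of_nonneg_right (hb k) (by positivity)

lemma hasDerivAt_tsum_mul_pow {b : ℕ → ℝ}
    (hb : ∀ k, |b k| ≤ 1 / (k.factorial : ℝ)) (y : ℝ) :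
    HasDerivAt (fun y : ℝ => ∑' k, b k * y ^ k) (∑' k : ℕ, (k + 1) * b (k + 1) * y ^ k) y := by
  set R : ℝ := |y| + 1
  have hu : Summable fun k : ℕ => (k : ℝ) * (1 / (k.factorial : ℝ)) * R ^ (k - 1) := by
    rw [← summable_nat_add_iff 1]
    refine (Real.summable_pow_div_factorial R).congr fun k => ?_
    rw [Nat.factorial_succ]
    push_cast
    have : (k.factorial : ℝ) ≠ 0 := by positivity
    field_simp
  have hbound : ∀ (k : ℕ) (x : ℝ), x ∈ Metric.ball (0 : ℝ) R →
      ‖b k * (k * x ^ (k - 1))‖ ≤ (k : ℝ) * (1 / (k.factorial : ℝ)) * R ^ (k - 1) := by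
    intro k x hx
    have hx' : |x| ≤ R := by simpa using (mem_ball_zero_iff.1 hx).le
    rw [norm_mul, norm_mul, norm_pow, Real.norm_eq_abs, Real.norm_eq_abs, Real.norm_eq_abs,
      Nat.abs_cast]
    calc |b k| * (k * |x| ^ (k - 1)) ≤ (1 / (k.factorial : ℝ)) * (k * R ^ (k - 1)) := by
          gcongr
          exact hb k
      _ = _ := by ring
  have hy : y ∈ Metric.ball (0 : ℝ) R := by
    rw [mem_ball_zero_iff, Real.norm_eq_abs]
    exact lt_add_one _
  have h := hasDerivAt_tsum_of_isPreconnected (g := fun (k : ℕ) (x : ℝ) => b k * x ^ k)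
    (g' := fun (k : ℕ) (x : ℝ) => b k * (k * x ^ (k - 1))) hu Metric.isOpen_ball
    (convex_ball (0 : ℝ) R).isPreconnected
    (fun k x _ => (hasDerivAt_pow k x).const_mul (b k)) hbound hy
    (summable_mul_pow_of_abs_le_inv_factorial hb y) hy
  refine h.congr_deriv ?_
  rw [(Summable.of_norm_bounded hu fun k => hbound k y hy).tsum_eq_zero_add]
  simp only [Nat.cast_zero, zero_mul, mul_zero, zero_add, add_tsub_cancel_right]
  exact tsum_congr fun k => by push_cast; ring

/-- The entire function `∑ yᵏ / (k!)²`, with `I₀(x) = besselSeriesZero (x² / 4)`. -/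
noncomputable def besselSeriesZero (y : ℝ) : ℝ :=
  ∑' k : ℕ, 1 / (k.factorial : ℝ) ^ 2 * y ^ k

/-- The entire function `∑ yᵏ / (k! (k+1)!)`, with `I₁(x) = x / 2 * besselSeriesOne (x² / 4)`. -/
noncomputable def besselSeriesOne (y : ℝ) : ℝ :=
  ∑' k : ℕ, 1 / ((k.factorial : ℝ) * ((k + 1).factorial : ℝ)) * y ^ k

lemma one_le_factorial_cast (k : ℕ) : (1 : ℝ) ≤ k.factorial := by
  exact_mod_cast Nat.one_le_iff_ne_zero.2 k.factorial_ne_zero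

lemma abs_besselSeriesZero_coeff_le (k : ℕ) :
    |1 / (k.factorial : ℝ) ^ 2| ≤ 1 / (k.factorial : ℝ) := by
  have := one_le_factorial_cast k
  rw [abs_of_nonneg (by positivity)]
  exact one_div_le_one_div_of_le (by positivity) (by nlinarith)

lemma abs_besselSeriesOne_coeff_le (k : ℕ) :
    |1 / ((k.factorial : ℝ) * ((k + 1).factorial : ℝ))| ≤ 1 / (k.factorial : ℝ) := by
  have h₀ := one_le_factorial_cast k
  have h₁ := one_le_factorial_cast (k + 1)
  rw [abs_of_nonneg (by positivity)]
  exact one_div_le_one_div_of_le (by positivity) (by nlinarith)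

lemma hasDerivAt_besselSeriesZero (y : ℝ) :
    HasDerivAt besselSeriesZero (besselSeriesOne y) y := by
  refine (hasDerivAt_tsum_mul_pow abs_besselSeriesZero_coeff_le y).congr_deriv ?_
  refine tsum_congr fun k => ?_
  have : (k.factorial : ℝ) ≠ 0 := by positivity
  rw [Nat.factorial_succ]
  push_cast
  field_simp

lemma continuous_besselSeriesZero : Continuous besselSeriesZero :=
  continuous_iff_continuousAt.2 fun y => (hasDerivAt_besselSeriesZero y).continuousAt

lemma continuous_besselSeriesOne : Continuous besselSeriesOne :=
  continuous_iff_continuousAt.2 fun y =>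
    (hasDerivAt_tsum_mul_pow abs_besselSeriesOne_coeff_le y).continuousAt

lemma hasDerivAt_mul_besselSeriesOne (y : ℝ) :
    HasDerivAt (fun y => y * besselSeriesOne y) (besselSeriesZero y) y := by
  have hb : ∀ k : ℕ, |(k : ℝ) / (k.factorial : ℝ) ^ 2| ≤ 1 / (k.factorial : ℝ) := by
    intro k
    have h₀ := one_le_factorial_cast k
    have h₁ : (k : ℝ) ≤ k.factorial := by exact_mod_cast Nat.self_le_factorial k
    rw [abs_of_nonneg (by positivity), div_le_div_iff₀ (by positivity) (by positivity)]
    nlinarith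
  have hfun : (fun y => y * besselSeriesOne y) =
      fun y : ℝ => ∑' k : ℕ, (k : ℝ) / (k.factorial : ℝ) ^ 2 * y ^ k := by
    funext x
    rw [(summable_mul_pow_of_abs_le_inv_factorial hb x).tsum_eq_zero_add, besselSeriesOne,
      ← tsum_mul_left]
    simp only [Nat.cast_zero, zero_div, zero_mul, zero_add]
    refine tsum_congr fun k => ?_
    have : (k.factorial : ℝ) ≠ 0 := by positivity
    rw [Nat.factorial_succ]
    push_cast
    field_simp
    ring
  rw [hfun]
  refine (hasDerivAt_tsum_mul_pow hb y).congr_deriv ?_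
  refine tsum_congr fun k => ?_
  have : (k.factorial : ℝ) ≠ 0 := by positivity
  rw [Nat.factorial_succ]
  push_cast
  field_simp

lemma besselI_eq_rpow_mul_tsum (ν : ℝ) {x : ℝ} (hx : 0 < x) :
    besselI ν x = (x / 2) ^ ν *
      ∑' k : ℕ, ((x / 2) ^ 2) ^ k / ((k.factorial : ℝ) * Real.Gamma (ν + k + 1)) := by
  rw [besselI, ← tsum_mul_left]
  refine tsum_congr fun k => ?_
  have h : (x / 2) ^ (2 * (k : ℝ) + ν) = (x / 2) ^ ν * ((x / 2) ^ 2) ^ k := by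
    rw [Real.rpow_add (by positivity), ← pow_mul, ← Real.rpow_natCast]
    push_cast
    ring
  rw [h, mul_div_assoc]

lemma besselI_zero_eq {x : ℝ} (hx : 0 < x) : besselI 0 x = besselSeriesZero ((x / 2) ^ 2) := by
  rw [besselI_eq_rpow_mul_tsum 0 hx, Real.rpow_zero, one_mul, besselSeriesZero]
  refine tsum_congr fun k => ?_
  rw [zero_add, Real.Gamma_nat_eq_factorial]
  ring

lemma besselI_one_eq {x : ℝ} (hx : 0 < x) :
    besselI 1 x = x / 2 * besselSeriesOne ((x / 2) ^ 2) := by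
  rw [besselI_eq_rpow_mul_tsum 1 hx, Real.rpow_one, besselSeriesOne]
  congr 1
  refine tsum_congr fun k => ?_
  rw [show (1 : ℝ) + k + 1 = ((k + 1 : ℕ) : ℝ) + 1 by push_cast; ring,
    Real.Gamma_nat_eq_factorial]
  ring

lemma integral_rpow_mul_sq_sub_sq_pow {a : ℝ} (ha : 0 < a) (k : ℕ) {q : ℝ} (hq : 0 < q) :
    ∫ x in (0 : ℝ)..a, x ^ (q - 1) * (a ^ 2 - x ^ 2) ^ k =
      1 / 2 * a ^ q * (a ^ 2) ^ k * Real.Gamma (q / 2) * k.factorial /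
        Real.Gamma (q / 2 + k + 1) := by
  induction k generalizing q with
  | zero =>
    have hΓ : Real.Gamma (q / 2) ≠ 0 := (Real.Gamma_pos_of_pos (by positivity)).ne'
    simp only [pow_zero, mul_one, Nat.factorial_zero, Nat.cast_one, Nat.cast_zero, add_zero]
    rw [integral_rpow (Or.inl (by linarith)), Real.Gamma_add_one (by positivity),
      sub_add_cancel, Real.zero_rpow hq.ne']
    field_simp
    ring
  | succ k ih =>
    have hint : ∀ (m : ℕ) {r : ℝ}, 0 < r →
        IntervalIntegrable (fun x : ℝ => x ^ (r - 1) * (a ^ 2 - x ^ 2) ^ m)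
          MeasureTheory.volume 0 a := fun m r hr =>
      (intervalIntegrable_rpow' (by linarith)).mul_continuousOn (by fun_prop)
    have hq2 : 0 < q + 2 := by linarith
    have hftc := integral_eq_sub_of_hasDerivAt_of_le (a := 0) (b := a)
      (f := fun x : ℝ => x ^ q * (a ^ 2 - x ^ 2) ^ (k + 1))
      (f' := fun x : ℝ => q * (x ^ (q - 1) * (a ^ 2 - x ^ 2) ^ (k + 1)) -
        2 * (k + 1) * (x ^ ((q + 2) - 1) * (a ^ 2 - x ^ 2) ^ k)) ha.le
      ((Real.continuous_rpow_const hq.le).mul (by fun_prop)).continuousOn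
      (fun x hx => by
        have h₁ := Real.hasDerivAt_rpow_const (x := x) (p := q) (Or.inl hx.1.ne')
        have h₂ := ((hasDerivAt_pow 2 x).const_sub (a ^ 2)).fun_pow (k + 1)
        refine (h₁.mul h₂).congr_deriv ?_
        have h₃ : x ^ ((q + 2) - 1) = x ^ q * x := by
          rw [show (q + 2) - 1 = q + 1 by ring, Real.rpow_add_one hx.1.ne']
        rw [h₃]
        simp only [add_tsub_cancel_right]
        push_cast
        ring)
      (((hint (k + 1) hq).const_mul q).sub ((hint k hq2).const_mul (2 * (k + 1))))
    rw [integral_sub ((hint (k + 1) hq).const_mul q) ((hint k hq2).const_mul (2 * (k + 1))),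
      intervalIntegral.integral_const_mul, intervalIntegral.integral_const_mul, ih hq2,
      Real.zero_rpow hq.ne'] at hftc
    rw [show (q + 2) / 2 = q / 2 + 1 by ring, Real.Gamma_add_one (by positivity),
      show q / 2 + 1 + k + 1 = q / 2 + (k + 1) + 1 by ring, Real.rpow_add ha,
      Real.rpow_two] at hftc
    rw [Nat.factorial_succ]
    push_cast
    simp only [sub_self, ne_eq, Nat.add_eq_zero_iff, one_ne_zero, and_false, not_false_eq_true,
      zero_pow, mul_zero, zero_mul] at hftc
    rw [sub_eq_zero] at hftc
    apply mul_left_cancel₀ hq.ne'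
    rw [hftc]
    field_simp
    ring

lemma hasSum_integral_rpow_mul_tsum {b : ℕ → ℝ} (hb : ∀ k, |b k| ≤ 1 / (k.factorial : ℝ))
    {a q : ℝ} (ha : 0 < a) (hq : 0 < q) (M : ℝ) :
    HasSum (fun k : ℕ => 1 / 2 * a ^ q * Real.Gamma (q / 2) *
        (b k * k.factorial * (M * a ^ 2) ^ k / Real.Gamma (q / 2 + k + 1)))
      (∫ x in (0 : ℝ)..a, x ^ (q - 1) * ∑' k, b k * (M * (a ^ 2 - x ^ 2)) ^ k) := by
  have hrpow : IntervalIntegrable (fun x : ℝ => x ^ (q - 1)) MeasureTheory.volume 0 a :=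
    intervalIntegrable_rpow' (by linarith)
  have hsum : Summable fun k : ℕ => (|M| * a ^ 2) ^ k / (k.factorial : ℝ) :=
    Real.summable_pow_div_factorial _
  have h := intervalIntegral.hasSum_integral_of_dominated_convergence
    (μ := MeasureTheory.volume) (a := 0) (b := a)
    (F := fun (k : ℕ) (x : ℝ) => x ^ (q - 1) * (b k * (M * (a ^ 2 - x ^ 2)) ^ k))
    (f := fun x => x ^ (q - 1) * ∑' k, b k * (M * (a ^ 2 - x ^ 2)) ^ k)
    (fun k x => x ^ (q - 1) * ((|M| * a ^ 2) ^ k / (k.factorial : ℝ)))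
    (fun k => ((intervalIntegrable_iff.1 (hrpow.mul_continuousOn
      (g := fun x : ℝ => b k * (M * (a ^ 2 - x ^ 2)) ^ k) (by fun_prop))).aestronglyMeasurable))
    (fun k => Filter.Eventually.of_forall fun x hx => by
      rw [Set.uIoc_of_le ha.le] at hx
      have hx0 := hx.1
      have hxa := hx.2
      rw [norm_mul, norm_mul, norm_pow, norm_mul, Real.norm_of_nonneg (by positivity),
        Real.norm_eq_abs, Real.norm_eq_abs, Real.norm_eq_abs,
        abs_of_nonneg (show 0 ≤ a ^ 2 - x ^ 2 by nlinarith), div_eq_inv_mul, ← one_div]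
      have := hb k
      have h₁ : 0 ≤ a ^ 2 - x ^ 2 := by nlinarith
      gcongr
      nlinarith)
    (Filter.Eventually.of_forall fun x _ => hsum.mul_left _)
    (by
      simp only [tsum_mul_left]
      exact hrpow.mul_const _)
    (Filter.Eventually.of_forall fun x _ =>
      (summable_mul_pow_of_abs_le_inv_factorial hb _).hasSum.mul_left _)
  refine (congrArg (HasSum · _) (funext fun k => ?_)).mpr h
  have : (fun x : ℝ => x ^ (q - 1) * (b k * (M * (a ^ 2 - x ^ 2)) ^ k)) =
      fun x : ℝ => b k * M ^ k * (x ^ (q - 1) * (a ^ 2 - x ^ 2) ^ k) := by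
    funext x
    rw [mul_pow]
    ring
  simp only [this]
  rw [intervalIntegral.integral_const_mul, integral_rpow_mul_sq_sub_sq_pow ha k hq, mul_pow]
  ring

lemma integral_rpow_mul_besselSeriesZero {a q z M : ℝ} (ha : 0 < a) (hq : 0 < q) (hz : 0 < z)
    (hM : M * a ^ 2 = (z / 2) ^ 2) :
    (z / 2) ^ (q / 2) * ∫ x in (0 : ℝ)..a, x ^ (q - 1) * besselSeriesZero (M * (a ^ 2 - x ^ 2)) =
      1 / 2 * a ^ q * Real.Gamma (q / 2) * besselI (q / 2) z := by
  have h := (hasSum_integral_rpow_mul_tsum abs_besselSeriesZero_coeff_le ha hq M).tsum_eq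
  simp only [besselSeriesZero]
  rw [← h, tsum_mul_left, besselI_eq_rpow_mul_tsum _ hz, hM]
  rw [mul_left_comm]
  congr 2
  refine tsum_congr fun k => ?_
  have : (k.factorial : ℝ) ≠ 0 := by positivity
  field_simp

lemma integral_rpow_mul_besselSeriesOne {a q z M : ℝ} (ha : 0 < a) (hq : 0 < q) (hz : 0 < z)
    (hM : M * a ^ 2 = (z / 2) ^ 2) :
    (z / 2) ^ (q / 2 - 1) * ((z / 2) ^ 2 *
        (∫ x in (0 : ℝ)..a, x ^ (q - 1) * besselSeriesOne (M * (a ^ 2 - x ^ 2))) +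
        1 / 2 * a ^ q) =
      1 / 2 * a ^ q * Real.Gamma (q / 2) * besselI (q / 2 - 1) z := by
  have hsum := hasSum_integral_rpow_mul_tsum abs_besselSeriesOne_coeff_le ha hq M
  set C : ℝ := 1 / 2 * a ^ q * Real.Gamma (q / 2) with hC
  have hC0 : C ≠ 0 := by positivity
  have hterm : ∀ k : ℕ, (z / 2) ^ 2 * (C * (1 / ((k.factorial : ℝ) * ((k + 1).factorial : ℝ)) *
        k.factorial * (M * a ^ 2) ^ k / Real.Gamma (q / 2 + k + 1))) =
      C * (((z / 2) ^ 2) ^ (k + 1) /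
        (((k + 1).factorial : ℝ) * Real.Gamma (q / 2 - 1 + (k + 1 : ℕ) + 1))) := by
    intro k
    have h₁ : (k.factorial : ℝ) ≠ 0 := by positivity
    rw [hM, show q / 2 - 1 + ((k + 1 : ℕ) : ℝ) + 1 = q / 2 + k + 1 by push_cast; ring]
    field_simp
    ring
  have hsum' := hsum.mul_left ((z / 2) ^ 2)
  simp only [hterm] at hsum'
  have hS : Summable fun k : ℕ => ((z / 2) ^ 2) ^ k /
      ((k.factorial : ℝ) * Real.Gamma (q / 2 - 1 + k + 1)) := by
    rw [← summable_nat_add_iff 1]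
    exact (summable_mul_left_iff hC0).1 hsum'.summable
  rw [besselI_eq_rpow_mul_tsum _ hz, hS.tsum_eq_zero_add, mul_left_comm C, mul_add C,
    ← tsum_mul_left, hsum'.tsum_eq]
  simp only [besselSeriesOne, pow_zero, Nat.factorial_zero, Nat.cast_one, one_mul,
    Nat.cast_zero, add_zero, sub_add_cancel]
  rw [hC]
  field_simp
  ring

lemma rpow_add_integral_eq {a M m p : ℝ} (ha : 0 < a) (hp : 0 < p)
    (hM : M = (m / 2) ^ 2) :
    a ^ p + (∫ x in (0 : ℝ)..a, x ^ p *
      (m * x * besselSeriesZero (M * (a ^ 2 - x ^ 2)) / (a + x) +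
        m / 2 * besselSeriesOne (M * (a ^ 2 - x ^ 2)) * (m * x + (a - x) / (a + x)))) =
    p * (∫ x in (0 : ℝ)..a, x ^ (p - 1) * besselSeriesZero (M * (a ^ 2 - x ^ 2))) +
      p * (m / 2) * (a * (∫ x in (0 : ℝ)..a, x ^ (p - 1) * besselSeriesOne (M * (a ^ 2 - x ^ 2))) -
        ∫ x in (0 : ℝ)..a, x ^ ((p + 1) - 1) * besselSeriesOne (M * (a ^ 2 - x ^ 2))) := by
  have hc₀ : Continuous fun x : ℝ => besselSeriesZero (M * (a ^ 2 - x ^ 2)) :=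
    continuous_besselSeriesZero.comp (by fun_prop)
  have hc₁ : Continuous fun x : ℝ => besselSeriesOne (M * (a ^ 2 - x ^ 2)) :=
    continuous_besselSeriesOne.comp (by fun_prop)
  have hr : ∀ {r : ℝ}, 0 < r → IntervalIntegrable (fun x : ℝ => x ^ (r - 1))
      MeasureTheory.volume 0 a := fun hr => intervalIntegrable_rpow' (by linarith)
  have hA := (hr hp).mul_continuousOn hc₀.continuousOn
  have hB := (hr hp).mul_continuousOn hc₁.continuousOn
  have hB' := (hr (add_pos hp one_pos)).mul_continuousOn hc₁.continuousOn
  have hne : ∀ x ∈ Set.Icc 0 a, a + x ≠ 0 := fun x hx => by linarith [hx.1]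
  have hcp : Continuous fun x : ℝ => x ^ p := Real.continuous_rpow_const hp.le
  have hN : IntervalIntegrable (fun x : ℝ => x ^ p *
      (m * x * besselSeriesZero (M * (a ^ 2 - x ^ 2)) / (a + x) +
        m / 2 * besselSeriesOne (M * (a ^ 2 - x ^ 2)) * (m * x + (a - x) / (a + x))))
      MeasureTheory.volume 0 a := by
    apply ContinuousOn.intervalIntegrable
    rw [Set.uIcc_of_le ha.le]
    refine hcp.continuousOn.mul (ContinuousOn.add (ContinuousOn.div ?_ ?_ hne)
      (ContinuousOn.mul (hc₁.const_mul (m / 2)).continuousOn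
        (ContinuousOn.add ?_ (ContinuousOn.div ?_ ?_ hne)))) <;> fun_prop
  have hE := ((hA.const_mul p).add (((hB.const_mul a).sub hB').const_mul (p * (m / 2))))
  have hftc := integral_eq_sub_of_hasDerivAt_of_le (a := 0) (b := a)
    (f := fun x : ℝ => -(x ^ p * besselSeriesZero (M * (a ^ 2 - x ^ 2))) -
      2 / m * (x ^ p * (M * (a ^ 2 - x ^ 2) * besselSeriesOne (M * (a ^ 2 - x ^ 2))) / (a + x)))
    ha.le
    (by
      refine ContinuousOn.sub (by fun_prop) (ContinuousOn.mul (by fun_prop)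
        (ContinuousOn.div ?_ ?_ hne)) <;> fun_prop)
    (fun x hx => by
      have hx0 : x ≠ 0 := hx.1.ne'
      have hax : a + x ≠ 0 := hne x ⟨hx.1.le, hx.2.le⟩
      have hxp : x ^ p = x ^ (p - 1) * x := by
        rw [← Real.rpow_add_one hx0, sub_add_cancel]
      have h₁ := Real.hasDerivAt_rpow_const (x := x) (p := p) (Or.inl hx0)
      have hw := ((hasDerivAt_pow 2 x).const_sub (a ^ 2)).const_mul M
      have h₂ := (hasDerivAt_besselSeriesZero (M * (a ^ 2 - x ^ 2))).comp x hw
      have h₃ := (hasDerivAt_mul_besselSeriesOne (M * (a ^ 2 - x ^ 2))).comp x hw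
      have h₄ := (hasDerivAt_id x).const_add a
      refine ((h₁.mul h₂).neg.sub (((h₁.mul h₃).div h₄ hax).const_mul (2 / m))).congr_deriv
        (g' := x ^ p *
          (m * x * besselSeriesZero (M * (a ^ 2 - x ^ 2)) / (a + x) +
            m / 2 * besselSeriesOne (M * (a ^ 2 - x ^ 2)) * (m * x + (a - x) / (a + x))) -
          (p * (x ^ (p - 1) * besselSeriesZero (M * (a ^ 2 - x ^ 2))) +
            p * (m / 2) * (a * (x ^ (p - 1) * besselSeriesOne (M * (a ^ 2 - x ^ 2))) -
              x ^ ((p + 1) - 1) * besselSeriesOne (M * (a ^ 2 - x ^ 2))))) ?_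
      simp only [Function.comp, Pi.mul_apply, id]
      generalize besselSeriesZero (M * (a ^ 2 - x ^ 2)) = f₀
      generalize besselSeriesOne (M * (a ^ 2 - x ^ 2)) = f₁
      rw [add_sub_cancel_right, hxp, hM]
      generalize x ^ (p - 1) = y
      push_cast
      field_simp
      ring)
    (hN.sub hE)
  rw [integral_sub hN hE, integral_add (hA.const_mul p)
      (((hB.const_mul a).sub hB').const_mul (p * (m / 2))),
    intervalIntegral.integral_const_mul, intervalIntegral.integral_const_mul,
    integral_sub (hB.const_mul a) hB', intervalIntegral.integral_const_mul] at hftc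
  have h₀ : besselSeriesZero 0 = 1 := by
    rw [besselSeriesZero, tsum_eq_single 0 fun k hk => by simp [hk]]
    simp
  simp only [sub_self, mul_zero, h₀, Real.zero_rpow hp.ne', zero_mul, zero_div] at hftc
  linarith

theorem stmt_7 (lam c t p : ℝ) (hlam : 0 < lam) (hc : 0 < c) (ht : 0 < t)
    (hp : 0 < p) :
    (c * t) ^ p / (besselI 0 (lam * t) + besselI 1 (lam * t))
      + (∫ x in (0:ℝ)..(c * t), x ^ p * qdens lam c x t)
    = (2 * c ^ 2 * t / lam) ^ (p / 2) *
        (Real.Gamma (p / 2 + 1) *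
            (besselI (p / 2) (lam * t) + besselI (p / 2 - 1) (lam * t))
          - p / 2 * Real.Gamma ((p + 1) / 2) * Real.sqrt (2 / (lam * t)) *
              besselI ((p - 1) / 2) (lam * t)) /
        (besselI 0 (lam * t) + besselI 1 (lam * t)) := by
  set D := besselI 0 (lam * t) + besselI 1 (lam * t) with hD
  have ha : 0 < c * t := by positivity
  have hm : 0 < lam / c := by positivity
  have hz : 0 < lam * t := by positivity
  have hMa : (lam / c / 2) ^ 2 * (c * t) ^ 2 = (lam * t / 2) ^ 2 := by field_simp
  have hdens : ∫ x in (0:ℝ)..(c * t), x ^ p * qdens lam c x t =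
      1 / D * ∫ x in (0:ℝ)..(c * t), x ^ p *
        (lam / c * x * besselSeriesZero ((lam / c / 2) ^ 2 * ((c * t) ^ 2 - x ^ 2)) / (c * t + x) +
          lam / c / 2 * besselSeriesOne ((lam / c / 2) ^ 2 * ((c * t) ^ 2 - x ^ 2)) *
            (lam / c * x + (c * t - x) / (c * t + x))) := by
    rw [← intervalIntegral.integral_const_mul]
    refine intervalIntegral.integral_congr_ae ?_
    have hae : ∀ᵐ x : ℝ, x ≠ c * t := by
      simp [MeasureTheory.ae_iff]
    filter_upwards [hae] with x hxne hx
    rw [Set.uIoc_of_le ha.le] at hx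
    have hx0 := hx.1
    have hxa : x < c * t := lt_of_le_of_ne hx.2 hxne
    have hpos : 0 < c ^ 2 * t ^ 2 - x ^ 2 := by nlinarith
    have hs : 0 < Real.sqrt (c ^ 2 * t ^ 2 - x ^ 2) := Real.sqrt_pos.2 hpos
    have harg : (lam / c * Real.sqrt (c ^ 2 * t ^ 2 - x ^ 2) / 2) ^ 2 =
        (lam / c / 2) ^ 2 * ((c * t) ^ 2 - x ^ 2) := by
      rw [div_pow, mul_pow, Real.sq_sqrt hpos.le]
      ring
    rw [qdens, ← hD, besselI_zero_eq (by positivity), besselI_one_eq (by positivity), harg]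
    have : c * t + x ≠ 0 := by positivity
    field_simp
  have hI := rpow_add_integral_eq (m := lam / c) ha hp rfl
  have hA := integral_rpow_mul_besselSeriesZero ha hp hz hMa
  have hB := integral_rpow_mul_besselSeriesOne ha hp hz hMa
  have hB' := integral_rpow_mul_besselSeriesOne ha (add_pos hp one_pos) hz hMa
  have hL : 0 < lam * t / 2 := by positivity
  have hscale : (2 * c ^ 2 * t / lam) ^ (p / 2) = (c * t) ^ p / (lam * t / 2) ^ (p / 2) := by
    rw [show 2 * c ^ 2 * t / lam = (c * t) ^ 2 / (lam * t / 2) by field_simp,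
      Real.div_rpow (by positivity) hL.le, ← Real.rpow_natCast, ← Real.rpow_mul ha.le]
    congr 2
    push_cast
    ring
  have hsqrt : Real.sqrt (2 / (lam * t)) = 1 / Real.sqrt (lam * t / 2) := by
    rw [show 2 / (lam * t) = (lam * t / 2)⁻¹ by field_simp, Real.sqrt_inv, one_div]
  have hexp₁ : (lam * t / 2) ^ (p / 2 - 1) = (lam * t / 2) ^ (p / 2) / (lam * t / 2) :=
    Real.rpow_sub_one hL.ne' _
  have hexp₂ : (lam * t / 2) ^ ((p + 1) / 2 - 1) =
      (lam * t / 2) ^ (p / 2) / Real.sqrt (lam * t / 2) := by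
    rw [Real.sqrt_eq_rpow, ← Real.rpow_sub hL]
    congr 1
    ring
  have hRR : Real.sqrt (lam * t / 2) ^ 2 = lam * t / 2 := Real.sq_sqrt hL.le
  have hR : 0 < Real.sqrt (lam * t / 2) := Real.sqrt_pos.2 hL
  have hQ : 0 < (lam * t / 2) ^ (p / 2) := Real.rpow_pos_of_pos hL _
  rw [hexp₁] at hB
  rw [hexp₂, show (p + 1) / 2 - 1 = (p - 1) / 2 by ring, Real.rpow_add_one ha.ne'] at hB'
  rw [hdens, hscale, hsqrt, Real.Gamma_add_one (by positivity), one_div_mul_eq_div, ← add_div, hI]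
  congr 1
  have hm2 : lam / c / 2 = lam * t / 2 / (c * t) := by field_simp
  rw [hm2] at hA hB hB' ⊢
  generalize (∫ x in (0 : ℝ)..(c * t), x ^ (p - 1) *
    besselSeriesZero ((lam * t / 2 / (c * t)) ^ 2 * ((c * t) ^ 2 - x ^ 2))) = A at hA ⊢
  generalize (∫ x in (0 : ℝ)..(c * t), x ^ (p - 1) *
    besselSeriesOne ((lam * t / 2 / (c * t)) ^ 2 * ((c * t) ^ 2 - x ^ 2))) = B at hB ⊢
  generalize (∫ x in (0 : ℝ)..(c * t), x ^ ((p + 1) - 1) *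
    besselSeriesOne ((lam * t / 2 / (c * t)) ^ 2 * ((c * t) ^ 2 - x ^ 2))) = B' at hB' ⊢
  generalize besselI (p / 2) (lam * t) = b₀ at hA ⊢
  generalize besselI (p / 2 - 1) (lam * t) = b₁ at hB ⊢
  generalize besselI ((p - 1) / 2) (lam * t) = b₂ at hB' ⊢
  generalize (c * t) ^ p = P at hA hB hB' ⊢
  generalize (lam * t / 2) ^ (p / 2) = Q at hA hB hB' hQ ⊢
  generalize Real.sqrt (lam * t / 2) = R at hB' hRR hR ⊢
  generalize c * t = a at ha hA hB hB' ⊢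
  rw [← hRR] at hB hB' ⊢
  have hA' : A = P * Real.Gamma (p / 2) * b₀ / (2 * Q) := by
    field_simp
    linear_combination 2 * hA
  have hB₁ : B = (P * Real.Gamma (p / 2) * b₁ * R ^ 2 / (2 * Q) - P / 2) / (R ^ 2) ^ 2 := by
    field_simp at hB ⊢
    linear_combination hB
  have hB₂ : B' = (P * a * Real.Gamma ((p + 1) / 2) * b₂ * R / (2 * Q) - P * a / 2) /
      (R ^ 2) ^ 2 := by
    field_simp at hB' ⊢
    linear_combination hB'
  rw [hA', hB₁, hB₂]
  field_simp
  ring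
end

section
/- Let λ, c > 0. On the open region {(x,t) : t > 0, |x| < ct}, the function F(x,t) = I₀((λ/c)√(c²t²−x²)) satisfies ∂²F/∂t² = c² ∂²F/∂x² + λ² F. -/
open Real

/-- The entire function `w ↦ ∑_{k≥0} w^k / (k! (k+j)!)`, for which `I_j(x) = (x/2)^j G_j(x²/4)`. -/
noncomputable def besselSeries (j : ℕ) (w : ℝ) : ℝ :=
  ∑' k : ℕ, w ^ k / ((k.factorial : ℝ) * ((k + j).factorial : ℝ))

theorem one_le_cast_factorial (n : ℕ) : (1 : ℝ) ≤ (n.factorial : ℝ) := by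
  exact_mod_cast Nat.one_le_iff_ne_zero.mpr n.factorial_ne_zero

theorem summable_besselSeries (j : ℕ) (w : ℝ) :
    Summable fun k : ℕ => w ^ k / ((k.factorial : ℝ) * ((k + j).factorial : ℝ)) := by
  refine Summable.of_norm_bounded (Real.summable_pow_div_factorial |w|) fun k => ?_
  have h1 := one_le_cast_factorial k
  have h2 := one_le_cast_factorial (k + j)
  rw [norm_div, norm_pow, Real.norm_eq_abs, Real.norm_of_nonneg (by positivity)]
  gcongr
  nlinarith

theorem hasDerivAt_besselSeries (j : ℕ) (w : ℝ) :
    HasDerivAt (besselSeries j) (besselSeries (j + 1) w) w := by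
  set R : ℝ := |w| + 1
  have hR : 0 < R := by positivity
  have hw : w ∈ Metric.ball (0 : ℝ) R := by simp [R]
  have hu : Summable fun k : ℕ => (k : ℝ) * R ^ (k - 1) / (k.factorial : ℝ) := by
    rw [← summable_nat_add_iff 1]
    refine (Real.summable_pow_div_factorial R).congr fun k => ?_
    rw [Nat.factorial_succ]
    push_cast [Nat.add_sub_cancel]
    field_simp
  have hbound : ∀ (k : ℕ) (y : ℝ), y ∈ Metric.ball (0 : ℝ) R →
      ‖(k : ℝ) * y ^ (k - 1) / ((k.factorial : ℝ) * ((k + j).factorial : ℝ))‖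
        ≤ (k : ℝ) * R ^ (k - 1) / (k.factorial : ℝ) := by
    intro k y hy
    have hy' : |y| ≤ R := by simpa using (mem_ball_zero_iff.mp hy).le
    have h1 := one_le_cast_factorial k
    have h2 := one_le_cast_factorial (k + j)
    rw [norm_div, norm_mul, norm_pow, Real.norm_eq_abs y, Real.norm_natCast,
      Real.norm_of_nonneg (by positivity)]
    gcongr
    nlinarith
  have h := hasDerivAt_tsum_of_isPreconnected hu Metric.isOpen_ball
    (convex_ball (0 : ℝ) R).isPreconnected
    (fun k y _ => (hasDerivAt_pow k y).div_const
      ((k.factorial : ℝ) * ((k + j).factorial : ℝ))) hbound hw (summable_besselSeries j w) hw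
  refine h.congr_deriv ?_
  rw [(Summable.of_norm_bounded hu fun k => hbound k w hw).tsum_eq_zero_add]
  simp only [Nat.cast_zero, zero_mul, zero_div, zero_add, besselSeries]
  refine tsum_congr fun k => ?_
  rw [Nat.factorial_succ k, Nat.add_sub_cancel, show k + 1 + j = k + (j + 1) by ring]
  push_cast
  field_simp

theorem besselSeries_recurrence (w : ℝ) :
    besselSeries 0 w = besselSeries 1 w + w * besselSeries 2 w := by
  have h0 := summable_besselSeries 0 w
  have h1 := summable_besselSeries 1 w
  have h2 := summable_besselSeries 2 w
  unfold besselSeries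
  rw [h0.tsum_eq_zero_add, h1.tsum_eq_zero_add, ← tsum_mul_left, add_assoc,
    ← ((summable_nat_add_iff 1).mpr h1).tsum_add (h2.mul_left w)]
  congr 1
  refine tsum_congr fun k => ?_
  simp only [add_zero, Nat.factorial_succ]
  push_cast
  field_simp
  ring

theorem besselI_zero_eq_besselSeries (x : ℝ) : besselI 0 x = besselSeries 0 (x ^ 2 / 4) := by
  refine tsum_congr fun k => ?_
  rw [zero_add, Real.Gamma_nat_eq_factorial, add_zero, add_zero,
    show (2 * (k : ℝ)) = ((2 * k : ℕ) : ℝ) by push_cast; ring, Real.rpow_natCast, pow_mul]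
  congr 2
  ring

theorem besselI_zero_mul_sqrt (a : ℝ) {v : ℝ} (hv : 0 ≤ v) :
    besselI 0 (a * Real.sqrt v) = besselSeries 0 (a ^ 2 / 4 * v) := by
  rw [besselI_zero_eq_besselSeries, mul_pow, Real.sq_sqrt hv]
  congr 1
  ring

/-- Second derivative of `besselSeries 0` composed with a quadratic polynomial. -/
theorem deriv_deriv_besselSeries_quadratic (p q s : ℝ) :
    deriv (fun y => deriv (fun z => besselSeries 0 (p * z ^ 2 + q)) y) s
      = besselSeries 2 (p * s ^ 2 + q) * (2 * p * s) ^ 2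
        + besselSeries 1 (p * s ^ 2 + q) * (2 * p) := by
  have hq : ∀ y : ℝ, HasDerivAt (fun z : ℝ => p * z ^ 2 + q) (2 * p * y) y := fun y => by
    refine (((hasDerivAt_pow 2 y).const_mul p).add_const q).congr_deriv ?_
    push_cast
    ring
  have h1 : (fun y => deriv (fun z => besselSeries 0 (p * z ^ 2 + q)) y)
      = fun y => besselSeries 1 (p * y ^ 2 + q) * (2 * p * y) :=
    funext fun y => ((hasDerivAt_besselSeries 0 _).comp y (hq y)).deriv
  rw [h1]
  have h2 := ((hasDerivAt_besselSeries 1 _).comp s (hq s)).mul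
    ((hasDerivAt_id s).const_mul (2 * p))
  refine h2.deriv.trans ?_
  simp only [Function.comp_apply, id_eq]
  ring

theorem deriv_deriv_congr {f g : ℝ → ℝ} {s : ℝ} (h : f =ᶠ[nhds s] g) :
    deriv (fun y => deriv (fun z => f z) y) s = deriv (fun y => deriv (fun z => g z) y) s :=
  h.deriv.deriv_eq

theorem stmt_11 (lam c : ℝ) (hlam : 0 < lam) (hc : 0 < c) :
    ∀ x t : ℝ, 0 < t → |x| < c * t →
      deriv (fun s => deriv (fun u =>
            besselI 0 (lam / c * Real.sqrt (c ^ 2 * u ^ 2 - x ^ 2))) s) t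
        = c ^ 2 * deriv (fun y => deriv (fun z =>
              besselI 0 (lam / c * Real.sqrt (c ^ 2 * t ^ 2 - z ^ 2))) y) x
          + lam ^ 2 * besselI 0 (lam / c * Real.sqrt (c ^ 2 * t ^ 2 - x ^ 2)) := by
  intro x t ht hx
  have hpos : 0 < c ^ 2 * t ^ 2 - x ^ 2 := by
    have := sq_lt_sq' (neg_lt_of_abs_lt hx) (lt_of_abs_lt hx)
    linarith [mul_pow c t 2]
  set a : ℝ := (lam / c) ^ 2 / 4 with ha
  have hT : (fun u => besselI 0 (lam / c * Real.sqrt (c ^ 2 * u ^ 2 - x ^ 2)))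
      =ᶠ[nhds t] fun u => besselSeries 0 (a * c ^ 2 * u ^ 2 + -(a * x ^ 2)) := by
    have hcont : Continuous fun u : ℝ => c ^ 2 * u ^ 2 - x ^ 2 := by fun_prop
    filter_upwards [hcont.continuousAt.eventually (lt_mem_nhds hpos)] with u hu
    rw [besselI_zero_mul_sqrt _ hu.le]
    congr 1
    ring
  have hX : (fun z => besselI 0 (lam / c * Real.sqrt (c ^ 2 * t ^ 2 - z ^ 2)))
      =ᶠ[nhds x] fun z => besselSeries 0 (-a * z ^ 2 + a * (c ^ 2 * t ^ 2)) := by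
    have hcont : Continuous fun z : ℝ => c ^ 2 * t ^ 2 - z ^ 2 := by fun_prop
    filter_upwards [hcont.continuousAt.eventually (lt_mem_nhds hpos)] with z hz
    rw [besselI_zero_mul_sqrt _ hz.le]
    congr 1
    ring
  rw [deriv_deriv_congr hT, deriv_deriv_congr hX, deriv_deriv_besselSeries_quadratic,
    deriv_deriv_besselSeries_quadratic, besselI_zero_mul_sqrt _ hpos.le, ← ha,
    besselSeries_recurrence,
    show a * c ^ 2 * t ^ 2 + -(a * x ^ 2) = a * (c ^ 2 * t ^ 2 - x ^ 2) by ring,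
    show -a * x ^ 2 + a * (c ^ 2 * t ^ 2) = a * (c ^ 2 * t ^ 2 - x ^ 2) by ring,
    show lam ^ 2 = 4 * a * c ^ 2 by rw [ha]; field_simp]
  ring
end
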